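/- arXiv:math/9201258 — 3 statements merged into one kernel-verified Lean document; each statement's English description precedes it below -/
import Mathlib

section
/- Fix an integer n ≥ 1 and a real number α ≠ 0. Let b⁰ be an invertible n×n real matrix, h an n×n real matrix, H = (b⁰)⁻¹h, H₀ = H − (tr(H)/n)·I, τ = tr(H), τ₀ = tr(H₀²). Suppose a, b : I → ℝ are twice differentiable on an open interval I containing 0 and satisfy a'' = −(n/4)(a')² + (τ₀/(4αn))(b')², b'' = −(n/2)·a'·b', with a(0) = b(0) = 0, a'(0) = τ/n, b'(0) = 1. Then the curve c(t) = b⁰·exp(a(t)·I + b(t)·H₀) satisfies c(0) = b⁰, c'(0) = h, c(t) is invertible for all t ∈ I, and c satisfies the geodesic equation c'' = c'c⁻¹c' − (1/2)tr(c⁻¹c')·c' + (1/(4αn))·tr(c⁻¹c'·c⁻¹c')·c + ((αn−1)/(4αn²))·tr(c⁻¹c')²·c on I. -/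
open Matrix

section helper

attribute [local instance] Matrix.linftyOpNormedRing Matrix.linftyOpNormedAlgebra

theorem helper_deriv {n : ℕ} (b0 H0 : Matrix (Fin n) (Fin n) ℝ)
    (a b : ℝ → ℝ) (da db t : ℝ) (ha : HasDerivAt a da t) (hb : HasDerivAt b db t) :
    HasDerivAt (fun s => b0 * NormedSpace.exp (a s • (1 : Matrix (Fin n) (Fin n) ℝ) + b s • H0))
      (b0 * NormedSpace.exp (a t • (1 : Matrix (Fin n) (Fin n) ℝ) + b t • H0) *
        (da • (1 : Matrix (Fin n) (Fin n) ℝ) + db • H0)) t := by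
  have key : ∀ s, NormedSpace.exp (a s • (1 : Matrix (Fin n) (Fin n) ℝ) + b s • H0)
      = NormedSpace.exp (a s • (1 : Matrix (Fin n) (Fin n) ℝ)) * NormedSpace.exp (b s • H0) := by
    intro s
    exact Matrix.exp_add_of_commute _ _ ((Commute.one_left _).smul_left _)
  have h1 := (hasDerivAt_exp_smul_const (𝕂 := ℝ) (1 : Matrix (Fin n) (Fin n) ℝ) (a t)).scomp t ha
  have h2 := (hasDerivAt_exp_smul_const (𝕂 := ℝ) H0 (b t)).scomp t hb
  have h3 := (h1.mul h2).const_mul b0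
  simp only [key]
  refine h3.congr_deriv ?_
  simp only [Function.comp, mul_one, mul_add, smul_mul_assoc, mul_smul_comm, mul_assoc]
  rfl

theorem helper_mul {n : ℕ} (f g : ℝ → Matrix (Fin n) (Fin n) ℝ)
    (df dg : Matrix (Fin n) (Fin n) ℝ) (t : ℝ) (hf : HasDerivAt f df t) (hg : HasDerivAt g dg t) :
    HasDerivAt (fun s => f s * g s) (df * g t + f t * dg) t := hf.mul hg

theorem helper_lin {n : ℕ} (H0 : Matrix (Fin n) (Fin n) ℝ)
    (a b : ℝ → ℝ) (da db t : ℝ) (ha : HasDerivAt a da t) (hb : HasDerivAt b db t) :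
    HasDerivAt (fun s => a s • (1 : Matrix (Fin n) (Fin n) ℝ) + b s • H0)
      (da • (1 : Matrix (Fin n) (Fin n) ℝ) + db • H0) t :=
  (ha.smul_const _).add (hb.smul_const _)

end helper

attribute [local instance] Matrix.normedAddCommGroup Matrix.normedSpace

theorem stmt8 (n : ℕ) (hn : 1 ≤ n) (α : ℝ) (hα : α ≠ 0)
    (I : Set ℝ) (hI : IsOpen I) (h0I : (0 : ℝ) ∈ I)
    (b0 h : Matrix (Fin n) (Fin n) ℝ) (hb0 : IsUnit b0)
    (H H0 : Matrix (Fin n) (Fin n) ℝ)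
    (hH : H = b0⁻¹ * h)
    (hH0 : H0 = H - (H.trace / (n : ℝ)) • (1 : Matrix (Fin n) (Fin n) ℝ))
    (τ τ₀ : ℝ) (hτ : τ = H.trace) (hτ₀ : τ₀ = (H0 * H0).trace)
    (a b a' b' a'' b'' : ℝ → ℝ)
    (ha' : ∀ t ∈ I, HasDerivAt a (a' t) t)
    (hb' : ∀ t ∈ I, HasDerivAt b (b' t) t)
    (ha'' : ∀ t ∈ I, HasDerivAt a' (a'' t) t)
    (hb'' : ∀ t ∈ I, HasDerivAt b' (b'' t) t)
    (hodea : ∀ t ∈ I, a'' t = -((n : ℝ) / 4) * (a' t) ^ 2 + (τ₀ / (4 * α * (n : ℝ))) * (b' t) ^ 2)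
    (hodeb : ∀ t ∈ I, b'' t = -((n : ℝ) / 2) * a' t * b' t)
    (ha0 : a 0 = 0) (hb0' : b 0 = 0) (ha'0 : a' 0 = τ / (n : ℝ)) (hb'0 : b' 0 = 1)
    (c : ℝ → Matrix (Fin n) (Fin n) ℝ)
    (hc : ∀ t, c t = b0 * NormedSpace.exp
        (a t • (1 : Matrix (Fin n) (Fin n) ℝ) + b t • H0)) :
    c 0 = b0 ∧
    (∀ t ∈ I, IsUnit (c t)) ∧
    ∃ c' c'' : ℝ → Matrix (Fin n) (Fin n) ℝ,
      (∀ t ∈ I, HasDerivAt c (c' t) t) ∧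
      (∀ t ∈ I, HasDerivAt c' (c'' t) t) ∧
      c' 0 = h ∧
      (∀ t ∈ I,
        c'' t = c' t * (c t)⁻¹ * c' t
          - (((1 : ℝ) / 2) * ((c t)⁻¹ * c' t).trace) • c' t
          + ((1 / (4 * α * (n : ℝ))) * (((c t)⁻¹ * c' t) * ((c t)⁻¹ * c' t)).trace) • c t
          + (((α * (n : ℝ) - 1) / (4 * α * (n : ℝ) ^ 2)) * ((c t)⁻¹ * c' t).trace ^ 2) • c t) := by
  have hn0 : (n : ℝ) ≠ 0 := by positivity
  have hb0d : IsUnit b0.det := (Matrix.isUnit_iff_isUnit_det _).1 hb0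
  have hunit : ∀ t, IsUnit (c t) := by
    intro t
    rw [hc t]
    exact hb0.mul (Matrix.isUnit_exp _)
  have hc0 : c 0 = b0 := by
    rw [hc 0, ha0, hb0']
    simp
  have htr : H0.trace = 0 := by
    rw [hH0]
    simp [Matrix.trace_sub, Matrix.trace_smul, hn0]
  have hcd : ∀ t ∈ I, HasDerivAt c
      (c t * (a' t • (1 : Matrix (Fin n) (Fin n) ℝ) + b' t • H0)) t := by
    intro t ht
    have h1 := helper_deriv b0 H0 a b (a' t) (b' t) t (ha' t ht) (hb' t ht)
    have h2 : c = fun s => b0 * NormedSpace.exp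
        (a s • (1 : Matrix (Fin n) (Fin n) ℝ) + b s • H0) := funext hc
    rw [h2]
    exact h1
  refine ⟨hc0, fun t _ => hunit t,
    fun t => c t * (a' t • (1 : Matrix (Fin n) (Fin n) ℝ) + b' t • H0),
    fun t => c t * (a' t • (1 : Matrix (Fin n) (Fin n) ℝ) + b' t • H0) *
        (a' t • (1 : Matrix (Fin n) (Fin n) ℝ) + b' t • H0) +
      c t * (a'' t • (1 : Matrix (Fin n) (Fin n) ℝ) + b'' t • H0), hcd, ?_, ?_, ?_⟩
  · intro t ht
    exact helper_mul c _ _ _ t (hcd t ht)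
      (helper_lin H0 a' b' (a'' t) (b'' t) t (ha'' t ht) (hb'' t ht))
  · simp only [hc0, ha'0, hb'0, hH0, hτ, one_smul]
    rw [add_sub_cancel, hH, Matrix.mul_nonsing_inv_cancel_left _ _ hb0d]
  · intro t ht
    have hd : IsUnit (c t).det := (Matrix.isUnit_iff_isUnit_det _).1 (hunit t)
    have hX : (a' t • (1 : Matrix (Fin n) (Fin n) ℝ) + b' t • H0).trace = n * a' t := by
      simp [Matrix.trace_add, Matrix.trace_smul, htr, mul_comm]
    have hXX : ((a' t • (1 : Matrix (Fin n) (Fin n) ℝ) + b' t • H0) *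
        (a' t • (1 : Matrix (Fin n) (Fin n) ℝ) + b' t • H0)).trace
        = n * a' t ^ 2 + b' t ^ 2 * τ₀ := by
      simp [Matrix.trace_add, Matrix.trace_smul, htr, mul_add, add_mul, hτ₀]
      ring
    have hcan : ∀ X, (c t)⁻¹ * (c t * X) = X :=
      fun X => Matrix.nonsing_inv_mul_cancel_left _ _ hd
    simp only [hcan, hX, hXX]
    rw [mul_assoc (c t * _) (c t)⁻¹ _, hcan, hodea t ht, hodeb t ht]
    simp only [mul_add, mul_smul_comm, mul_one]
    match_scalars <;> field_simp <;> ring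
end

section
/- Let b be an invertible symmetric n×n real matrix and h a symmetric n×n real matrix; set H = b⁻¹h and H₀ = H − (tr(H)/n)·I. Then for all real s, u, the matrix b·exp(s·I + u·H₀) is symmetric and invertible, and with C = exp((s·I + u·H₀)/2) one has b·exp(s·I + u·H₀) = Cᵀ·b·C with C invertible; in particular b·exp(s·I + u·H₀) is congruent to b and hence has the same signature as b. -/
open Matrix

theorem exp_transpose_mul_aux {n : ℕ} (b X : Matrix (Fin n) (Fin n) ℝ) (hb : IsUnit b)
    (hX : Xᵀ * b = b * X) :
    (NormedSpace.exp X)ᵀ * b = b * NormedSpace.exp X := by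
  have hd : IsUnit b.det := (Matrix.isUnit_iff_isUnit_det b).mp hb
  have h1 : Xᵀ = b * X * b⁻¹ := by
    rw [← hX, Matrix.mul_assoc, Matrix.mul_nonsing_inv b hd, Matrix.mul_one]
  rw [← Matrix.exp_transpose, h1, Matrix.exp_conj b X hb, Matrix.mul_assoc,
    Matrix.nonsing_inv_mul b hd, Matrix.mul_one]

theorem stmt11 (n : ℕ) (hn : 1 ≤ n)
    (b h : Matrix (Fin n) (Fin n) ℝ) (hb : IsUnit b)
    (hbsymm : bᵀ = b) (hhsymm : hᵀ = h)
    (H H0 : Matrix (Fin n) (Fin n) ℝ)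
    (hH : H = b⁻¹ * h)
    (hH0 : H0 = H - (H.trace / (n : ℝ)) • (1 : Matrix (Fin n) (Fin n) ℝ))
    (s u : ℝ) :
    (b * NormedSpace.exp (s • (1 : Matrix (Fin n) (Fin n) ℝ) + u • H0))ᵀ
        = b * NormedSpace.exp (s • (1 : Matrix (Fin n) (Fin n) ℝ) + u • H0) ∧
    IsUnit (b * NormedSpace.exp (s • (1 : Matrix (Fin n) (Fin n) ℝ) + u • H0)) ∧
    IsUnit (NormedSpace.exp
        (((1 : ℝ) / 2) • (s • (1 : Matrix (Fin n) (Fin n) ℝ) + u • H0))) ∧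
    b * NormedSpace.exp (s • (1 : Matrix (Fin n) (Fin n) ℝ) + u • H0)
      = (NormedSpace.exp (((1 : ℝ) / 2) • (s • (1 : Matrix (Fin n) (Fin n) ℝ) + u • H0)))ᵀ
          * b
          * NormedSpace.exp (((1 : ℝ) / 2) • (s • (1 : Matrix (Fin n) (Fin n) ℝ) + u • H0)) := by
  have hd : IsUnit b.det := (Matrix.isUnit_iff_isUnit_det b).mp hb
  have hbH : b * H = h := by
    rw [hH, ← Matrix.mul_assoc, Matrix.mul_nonsing_inv b hd, Matrix.one_mul]
  have hHb : Hᵀ * b = b * H := by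
    have h2 := congrArg Matrix.transpose hbH
    rw [Matrix.transpose_mul, hbsymm, hhsymm] at h2
    rw [h2, hbH]
  have hX : (s • (1 : Matrix (Fin n) (Fin n) ℝ) + u • H0)ᵀ * b
      = b * (s • (1 : Matrix (Fin n) (Fin n) ℝ) + u • H0) := by
    rw [hH0]
    simp [Matrix.add_mul, Matrix.mul_add, Matrix.sub_mul, Matrix.mul_sub, hHb]
  generalize s • (1 : Matrix (Fin n) (Fin n) ℝ) + u • H0 = X at hX ⊢
  have hY : (((1 : ℝ) / 2) • X)ᵀ * b = b * (((1 : ℝ) / 2) • X) := by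
    rw [Matrix.transpose_smul, Matrix.smul_mul, Matrix.mul_smul, hX]
  refine ⟨?_, hb.mul (Matrix.isUnit_exp X), Matrix.isUnit_exp _, ?_⟩
  · rw [Matrix.transpose_mul, hbsymm, exp_transpose_mul_aux b X hb hX]
  · rw [exp_transpose_mul_aux b _ hb hY, Matrix.mul_assoc,
      ← Matrix.exp_add_of_commute _ _ (Commute.refl _), ← add_smul]
    norm_num
end

section
/- Let b be an invertible skew-symmetric n×n real matrix (bᵀ = −b) and h a skew-symmetric n×n real matrix (hᵀ = −h); set H = b⁻¹h and H₀ = H − (tr(H)/n)·I. Then Hᵀ·b = b·H, and for all real s, u the matrix b·exp(s·I + u·H₀) is skew-symmetric. -/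
open Matrix

theorem stmt14 (n : ℕ) (hn : 1 ≤ n)
    (b h : Matrix (Fin n) (Fin n) ℝ) (hb : IsUnit b)
    (hbskew : bᵀ = -b) (hhskew : hᵀ = -h)
    (H H0 : Matrix (Fin n) (Fin n) ℝ)
    (hH : H = b⁻¹ * h)
    (hH0 : H0 = H - (H.trace / (n : ℝ)) • (1 : Matrix (Fin n) (Fin n) ℝ))
    (s u : ℝ) :
    Hᵀ * b = b * H ∧
    (b * NormedSpace.exp (s • (1 : Matrix (Fin n) (Fin n) ℝ) + u • H0))ᵀ
      = -(b * NormedSpace.exp (s • (1 : Matrix (Fin n) (Fin n) ℝ) + u • H0)) := by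
  have hd : IsUnit b.det := (Matrix.isUnit_iff_isUnit_det b).1 hb
  have hbi : b * b⁻¹ = 1 := Matrix.mul_nonsing_inv b hd
  have hib : b⁻¹ * b = 1 := Matrix.nonsing_inv_mul b hd
  have hneg : (-b)⁻¹ = -b⁻¹ := Matrix.inv_eq_right_inv (by rw [neg_mul_neg, hbi])
  have h1 : Hᵀ * b = b * H := by
    rw [hH, Matrix.transpose_mul, Matrix.transpose_nonsing_inv, hbskew, hhskew, hneg,
      neg_mul_neg, Matrix.mul_assoc, hib, ← Matrix.mul_assoc, hbi, Matrix.mul_one, Matrix.one_mul]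
  refine ⟨h1, ?_⟩
  set M := s • (1 : Matrix (Fin n) (Fin n) ℝ) + u • H0 with hM
  have h2 : Mᵀ * b = b * M := by
    simp [hM, hH0, Matrix.add_mul, Matrix.mul_add, Matrix.sub_mul, Matrix.mul_sub, h1]
  have h3 : Mᵀ = b * M * b⁻¹ := by
    rw [← h2, Matrix.mul_assoc, hbi, Matrix.mul_one]
  rw [Matrix.transpose_mul, ← Matrix.exp_transpose, h3, Matrix.exp_conj b M hb, hbskew,
    Matrix.mul_neg, Matrix.mul_assoc, hib, Matrix.mul_one]
end
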